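/- Let G = (V, E) be a finite τ-critical simple graph of order n = |V| ≥ 4 with transversal number τ(G) = t = n − 2, and suppose G is regular of degree n − 3. Then G is isomorphic to the disjoint union of two edges 2K_2 or to the five-cycle C_5. -/

import Mathlib

open SimpleGraph

/-- A transversal set (vertex cover): a set of vertices meeting every edge. -/
def IsTransversal {V : Type*} (G : SimpleGraph V) (S : Set V) : Prop :=
  ∀ ⦃u v : V⦄, G.Adj u v → u ∈ S ∨ v ∈ S

/-- The transversal number: minimum cardinality of a transversal set. -/
noncomputable def tau {V : Type*} [Fintype V] (G : SimpleGraph V) : ℕ :=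
  sInf {n | ∃ S : Finset V, IsTransversal G ↑S ∧ S.card = n}

/-- A graph with no isolated vertices is τ-critical if deleting any edge
decreases the transversal number by one. -/
def TauCritical {V : Type*} [Fintype V] (G : SimpleGraph V) : Prop :=
  (∀ v : V, ∃ u, G.Adj v u) ∧
  ∀ e ∈ G.edgeSet, tau (G.deleteEdges {e}) = tau G - 1

/-- `2K₂`: the disjoint union of two edges, on vertex set `Fin 4`. -/
def twoK2 : SimpleGraph (Fin 4) := SimpleGraph.fromEdgeSet {s(0, 1), s(2, 3)}

theorem tau_le_card {V : Type*} [Fintype V] {G : SimpleGraph V} {S : Finset V}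
    (hS : IsTransversal G ↑S) : tau G ≤ S.card :=
  Nat.sInf_le ⟨S, hS, rfl⟩

theorem exists_isTransversal_card_eq_tau {V : Type*} [Fintype V] (G : SimpleGraph V) :
    ∃ S : Finset V, IsTransversal G ↑S ∧ S.card = tau G :=
  Nat.sInf_mem (s := {n | ∃ S : Finset V, IsTransversal G ↑S ∧ S.card = n})
    ⟨_, Finset.univ, fun u v _ => Or.inl (by simp), rfl⟩

/-- If the transversal number is at least `|V| - 2`, the complement graph is triangle-free. -/
theorem compl_not_triangle_of_card_le_tau_add_two {V : Type*} [Fintype V] {G : SimpleGraph V}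
    (ht : Fintype.card V ≤ tau G + 2) {x y z : V}
    (hxy : Gᶜ.Adj x y) (hxz : Gᶜ.Adj x z) : ¬ Gᶜ.Adj y z := by
  classical
  intro hyz
  have htrans : IsTransversal G ↑(({x, y, z} : Finset V)ᶜ) := by
    intro u v huv
    by_contra! h
    simp only [compl_adj] at hxy hxz hyz
    simp only [Finset.mem_coe, Finset.mem_compl, Finset.mem_insert, Finset.mem_singleton,
      not_not] at h
    have hne := huv.ne
    grind [G.adj_comm]
  have hcard : ({x, y, z} : Finset V).card = 3 :=
    Finset.card_eq_three.2 ⟨x, y, z, hxy.ne, hxz.ne, hyz.ne, rfl⟩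
  have hle := tau_le_card htrans
  have hadd := Finset.card_add_card_compl ({x, y, z} : Finset V)
  omega

/-- In a `τ`-critical graph with `τ = |V| - 2`, the ends of every edge have a common
non-neighbour. -/
theorem TauCritical.exists_common_compl_adj {V : Type*} [Fintype V] {G : SimpleGraph V}
    (hcrit : TauCritical G) (hV : 3 ≤ Fintype.card V) (ht : tau G + 2 = Fintype.card V)
    {u v : V} (huv : G.Adj u v) : ∃ w, Gᶜ.Adj u w ∧ Gᶜ.Adj v w := by
  classical
  obtain ⟨S, hS, hcard⟩ := exists_isTransversal_card_eq_tau (G.deleteEdges {s(u, v)})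
  rw [hcrit.2 _ huv] at hcard
  have hnot : ¬ (u ∈ S ∨ v ∈ S) := by
    intro h
    have hSG : IsTransversal G ↑S := by
      intro x y hxy
      by_cases he : s(x, y) = s(u, v)
      · rcases Sym2.eq_iff.1 he with ⟨rfl, rfl⟩ | ⟨rfl, rfl⟩
        · exact h
        · exact h.symm
      · exact hS (by simpa [deleteEdges_adj] using ⟨hxy, by simpa using he⟩)
    have hle := tau_le_card hSG
    omega
  push Not at hnot
  have hadd := Finset.card_add_card_compl S
  obtain ⟨w, hw, hwuv⟩ : ∃ w ∈ Sᶜ, w ∉ ({u, v} : Finset V) :=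
    Finset.exists_mem_notMem_of_card_lt_card (by
      have := Finset.card_le_two (a := u) (b := v)
      omega)
  simp only [Finset.mem_insert, Finset.mem_singleton, not_or] at hwuv
  rw [Finset.mem_compl] at hw
  have key : ∀ x, x ∉ S → x ≠ w → Gᶜ.Adj x w := by
    intro x hx hxw
    refine (compl_adj _ _ _).2 ⟨hxw, fun hadj => ?_⟩
    have := hS (show (G.deleteEdges {s(u, v)}).Adj x w by
      rw [deleteEdges_adj]
      refine ⟨hadj, fun h => ?_⟩
      rcases Sym2.eq_iff.1 h with ⟨-, h⟩ | ⟨-, h⟩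
      · exact hwuv.2 h
      · exact hwuv.1 h)
    exact this.elim hx hw
  exact ⟨w, key u hnot.1 (Ne.symm hwuv.1), key v hnot.2 (Ne.symm hwuv.2)⟩

/-- In a `2`-regular graph, a neighbour `y` of `x` has a companion `z` so that the
neighbourhood of `x` is `{y, z}`. -/
theorem exists_adj_iff_of_degree_eq_two {V : Type*} {H : SimpleGraph V} {x y : V}
    [Fintype (H.neighborSet x)] (hdeg : H.degree x = 2) (hxy : H.Adj x y) :
    ∃ z, z ≠ y ∧ ∀ w, H.Adj x w ↔ w = y ∨ w = z := by
  classical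
  obtain ⟨a, b, hab, hN⟩ := Finset.card_eq_two.1 hdeg
  have hmem : ∀ w, H.Adj x w ↔ w = a ∨ w = b := fun w => by
    rw [← mem_neighborFinset, hN]
    simp
  rcases (hmem y).1 hxy with rfl | rfl
  · exact ⟨b, hab.symm, hmem⟩
  · exact ⟨a, hab, fun w => (hmem w).trans or_comm⟩

theorem nonempty_iso_of_bijective {V W : Type*} {G : SimpleGraph V} {H : SimpleGraph W}
    {f : W → V} (hf : Function.Bijective f) (hadj : ∀ i j, G.Adj (f i) (f j) ↔ H.Adj i j) :
    Nonempty (G ≃g H) :=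
  ⟨RelIso.symm ⟨Equiv.ofBijective f hf, fun {i j} => hadj i j⟩⟩

theorem regular_case_complement_two_regular {V : Type*} [Fintype V] [DecidableEq V]
    (G : SimpleGraph V) [DecidableRel G.Adj] (n : ℕ)
    (hcrit : TauCritical G) (hn : Fintype.card V = n) (hn4 : 4 ≤ n)
    (ht : tau G = n - 2) (hreg : G.IsRegularOfDegree (n - 3)) :
    Nonempty (G ≃g twoK2) ∨ Nonempty (G ≃g cycleGraph 5) := by
  have hdeg : ∀ x, Gᶜ.degree x = 2 := fun x => by
    rw [degree_compl, hreg.degree_eq x]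
    omega
  have htri : ∀ {x y z}, Gᶜ.Adj x y → Gᶜ.Adj x z → ¬ Gᶜ.Adj y z :=
    compl_not_triangle_of_card_le_tau_add_two (by omega)
  have hcommon : ∀ {x y}, G.Adj x y → ∃ w, Gᶜ.Adj x w ∧ Gᶜ.Adj y w :=
    hcrit.exists_common_compl_adj (by omega) (by omega)
  have hG : ∀ x y, G.Adj x y ↔ x ≠ y ∧ ¬ Gᶜ.Adj x y := fun x y => by
    rw [compl_adj]
    exact ⟨fun h => ⟨h.ne, fun h' => h'.2 h⟩, fun h => by_contra fun h' => h.2 ⟨h.1, h'⟩⟩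
  obtain ⟨v⟩ : Nonempty V := Fintype.card_pos_iff.1 (by omega)
  obtain ⟨a, hva⟩ : ∃ a, Gᶜ.Adj v a := by
    rw [← degree_pos_iff_exists_adj, hdeg]
    norm_num
  obtain ⟨b, hba, hv⟩ := exists_adj_iff_of_degree_eq_two (hdeg v) hva
  have hvb : Gᶜ.Adj v b := (hv b).2 (Or.inr rfl)
  obtain ⟨c, hcv, ha⟩ := exists_adj_iff_of_degree_eq_two (hdeg a) hva.symm
  obtain ⟨d, hdv, hb⟩ := exists_adj_iff_of_degree_eq_two (hdeg b) hvb.symm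
  have hac : Gᶜ.Adj a c := (ha c).2 (Or.inr rfl)
  have hbd : Gᶜ.Adj b d := (hb d).2 (Or.inr rfl)
  have hnab : ¬ Gᶜ.Adj a b := htri hva hvb
  have hnvc : ¬ Gᶜ.Adj v c := htri hva.symm hac
  have hnvd : ¬ Gᶜ.Adj v d := htri hvb.symm hbd
  have hall : ∀ x, x = v ∨ x = a ∨ x = b ∨ x = c ∨ x = d := by
    intro x
    by_cases hxv : v = x
    · exact Or.inl hxv.symm
    by_cases hvx : Gᶜ.Adj v x
    · rcases (hv x).1 hvx with h | h <;> simp [h]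
    obtain ⟨w, hvw, hxw⟩ := hcommon ((hG v x).2 ⟨hxv, hvx⟩)
    rcases (hv w).1 hvw with rfl | rfl
    · rcases (ha x).1 hxw.symm with h | h <;> simp [h]
    · rcases (hb x).1 hxw.symm with h | h <;> simp [h]
  by_cases hcd : c = d
  · subst hcd
    left
    have hinj : Function.Injective ![v, c, a, b] := by
      have := hva.ne; have := hvb.ne; have := hac.ne; have := hbd.ne
      intro i j
      fin_cases i <;> fin_cases j <;> simp <;> grind
    have hsurj : Function.Surjective ![v, c, a, b] := by
      intro x
      rcases hall x with rfl | rfl | rfl | rfl | rfl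
      exacts [⟨0, rfl⟩, ⟨2, rfl⟩, ⟨3, rfl⟩, ⟨1, rfl⟩, ⟨1, rfl⟩]
    refine nonempty_iso_of_bijective ⟨hinj, hsurj⟩ fun i j => ?_
    rw [hG, hinj.ne_iff]
    fin_cases i <;> fin_cases j <;> simp [twoK2] <;> grind [Gᶜ.adj_comm]
  · right
    have hncb : ¬ Gᶜ.Adj c b := fun h => by grind [(hb c).1 h.symm]
    have hnad : ¬ Gᶜ.Adj a d := fun h => by grind [(ha d).1 h]
    have hinj : Function.Injective ![v, c, b, a, d] := by
      have := hva.ne; have := hvb.ne; have := hac.ne; have := hbd.ne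
      have : c ≠ b := fun h => hnab (h ▸ hac)
      have : a ≠ d := fun h => hnvd (h ▸ hva)
      intro i j
      fin_cases i <;> fin_cases j <;> simp <;> grind
    have hadj_cd : Gᶜ.Adj c d := by
      obtain ⟨e, hea, hc⟩ := exists_adj_iff_of_degree_eq_two (hdeg c) hac.symm
      have hce : Gᶜ.Adj c e := (hc e).2 (Or.inr rfl)
      rcases hall e with rfl | rfl | rfl | rfl | rfl
      exacts [absurd hce.symm hnvc, absurd rfl hea, absurd hce hncb, absurd rfl hce.ne, hce]
    have hsurj : Function.Surjective ![v, c, b, a, d] := by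
      intro x
      rcases hall x with rfl | rfl | rfl | rfl | rfl
      exacts [⟨0, rfl⟩, ⟨3, rfl⟩, ⟨2, rfl⟩, ⟨1, rfl⟩, ⟨4, rfl⟩]
    refine nonempty_iso_of_bijective ⟨hinj, hsurj⟩ fun i j => ?_
    rw [hG, hinj.ne_iff]
    have hcyc : (cycleGraph 5).Adj i j ↔ i - j = 1 ∨ j - i = 1 := cycleGraph_adj
    rw [hcyc]
    fin_cases i <;> fin_cases j <;> simp <;> grind [Gᶜ.adj_comm]
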